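/- arXiv:0805.1327 — 11 statements merged into one kernel-verified Lean document; each statement's English description precedes it below -/
import Mathlib

section
/- Let Y be a finite set, m ≥ 1, and let W be a memoryless channel from the constellation X = {0,1}^m to Y with transition probabilities W(x)(y) > 0 and ∑_{y∈Y} W(x)(y) = 1 for each x. Define the bit marginals p_j(y|b) = 2^{-(m-1)} ∑_{x : x_j = b} W(x)(y) and the bitwise mutual informations I(B_j;Y) = ½ ∑_{b∈{0,1}} ∑_{y∈Y} p_j(y|b) log( p_j(y|b) / (½ ∑_{b'∈{0,1}} p_j(y|b')) ). Then the BICM capacity ∑_{j=1}^m I(B_j;Y) is achievable: for every ε > 0 there exist a block length N ≥ 1, a finite message set M, an encoder φ : M → ((Fin N) → {0,1}^m) and a decoder ψ : ((Fin N) → Y) → Option M such that (1/N) log |M| ≥ ∑_{j=1}^m I(B_j;Y) − ε and the average error probability (1/|M|) ∑_{w∈M} ∑_{y∈Y^N, ψ(y) ≠ some w} ∏_{k=1}^N W(φ(w)_k)(y_k) is at most ε. -/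
open Real BigOperators Finset
open scoped Classical

/-- Bit marginal `p_j(y|b) = 2^{-(m-1)} ∑_{x : x_j = b} W(x)(y)` of a BICM channel. -/
noncomputable def bicmBitMarginal {Y : Type} [Fintype Y] {m : ℕ}
    (W : (Fin m → Bool) → Y → ℝ) (j : Fin m) (b : Bool) (y : Y) : ℝ :=
  (∑ x ∈ Finset.univ.filter (fun x : Fin m → Bool => x j = b), W x y) / 2 ^ (m - 1)

/-- The BICM capacity `∑_j I(B_j;Y)` with uniform inputs; natural logarithms. -/
noncomputable def bicmCapacity {Y : Type} [Fintype Y] {m : ℕ}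
    (W : (Fin m → Bool) → Y → ℝ) : ℝ :=
  ∑ j : Fin m, (1 / 2 : ℝ) * ∑ b : Bool, ∑ y : Y,
    bicmBitMarginal W j b y *
      Real.log (bicmBitMarginal W j b y /
        ((1 / 2 : ℝ) * ∑ b' : Bool, bicmBitMarginal W j b' y))

/-- Feinstein's greedy construction of a code, for an arbitrary decoding relation `D`. The message
added last has priority in the decoder. -/
theorem exists_code_sum_error_le {A B : Type} [Fintype A] [Nonempty A] [Fintype B]
    (V : A → B → ℝ) (hV : ∀ a b, 0 ≤ V a b) (hV1 : ∀ a, ∑ b, V a b = 1)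
    (D : A → B → Prop) (α β : ℝ) (hβ : 0 ≤ β)
    (hα : ∑ a, ∑ b, (if D a b then 0 else V a b) ≤ Fintype.card A * α)
    (hD : ∀ b, ∑ a, (if D a b then (1 : ℝ) else 0) ≤ Fintype.card A * β) (K : ℕ) :
    ∃ (M : Type) (_ : Fintype M) (φ : M → A) (ψ : B → Option M), Fintype.card M = K ∧
      ∑ w : M, ∑ b ∈ Finset.univ.filter (fun b => ψ b ≠ some w), V (φ w) b
        ≤ K * (α + (K - 1) * β) := by
  induction K with
  | zero =>
    exact ⟨Empty, inferInstance, Empty.elim, fun _ => none, by simp, by simp⟩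
  | succ K ih =>
    obtain ⟨M, _, φ, ψ, hM, hT⟩ := ih
    obtain ⟨a, -, ha⟩ : ∃ a ∈ (Finset.univ : Finset A),
        (∑ b, (if D a b then 0 else V a b)) + ∑ w, ∑ b, (if D a b then V (φ w) b else 0)
          ≤ α + K * β := by
      apply Finset.exists_le_of_sum_le Finset.univ_nonempty
      have h2 : ∑ a, ∑ w, ∑ b, (if D a b then V (φ w) b else 0)
          ≤ K * (Fintype.card A * β) := by
        calc ∑ a, ∑ w, ∑ b, (if D a b then V (φ w) b else 0)
            = ∑ w, ∑ b, V (φ w) b * ∑ a, (if D a b then (1 : ℝ) else 0) := by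
              rw [Finset.sum_comm]
              refine Finset.sum_congr rfl fun w _ => ?_
              rw [Finset.sum_comm]
              refine Finset.sum_congr rfl fun b _ => ?_
              rw [Finset.mul_sum]
              exact Finset.sum_congr rfl fun a _ => by split_ifs <;> simp
          _ ≤ ∑ w, ∑ b, V (φ w) b * (Fintype.card A * β) := by
              gcongr with w _ b _
              · exact hV _ _
              · exact hD b
          _ = K * (Fintype.card A * β) := by
              simp [← Finset.sum_mul, hV1, hM]
      rw [Finset.sum_add_distrib, Finset.sum_const, Finset.card_univ, nsmul_eq_mul]
      linarith
    refine ⟨Option M, inferInstance, fun w => w.elim a φ,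
      fun b => if D a b then some none else (ψ b).map some, by simp [hM], ?_⟩
    rw [Fintype.sum_option]
    have h1 : ∑ b ∈ Finset.univ.filter (fun b =>
        (if D a b then some none else (ψ b).map some) ≠ some (none : Option M)), V a b
        ≤ ∑ b, (if D a b then 0 else V a b) := by
      rw [Finset.sum_filter]
      refine Finset.sum_le_sum fun b _ => ?_
      by_cases h : D a b
      · simp [h]
      · simp only [h, if_false]
        split_ifs
        · exact le_rfl
        · exact hV _ _
    have h2 : ∑ w : M, ∑ b ∈ Finset.univ.filter (fun b =>
        (if D a b then some none else (ψ b).map some) ≠ some (some w)), V (φ w) b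
        ≤ (∑ w : M, ∑ b ∈ Finset.univ.filter (fun b => ψ b ≠ some w), V (φ w) b)
          + ∑ w, ∑ b, (if D a b then V (φ w) b else 0) := by
      rw [← Finset.sum_add_distrib]
      refine Finset.sum_le_sum fun w _ => ?_
      rw [Finset.sum_filter, Finset.sum_filter, ← Finset.sum_add_distrib]
      refine Finset.sum_le_sum fun b _ => ?_
      have := hV (φ w) b
      by_cases h : D a b
      · simp only [h, if_true]
        split_ifs <;> simp_all
      · simp only [h, if_false, add_zero]
        split_ifs <;> simp_all
    simp only [Option.elim]
    push_cast
    nlinarith [mul_nonneg (Nat.cast_nonneg (α := ℝ) K) hβ]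

/-- Product weights sum to the product of the sums. -/
theorem sum_pi_prod_eq_one {Z : Type} [Fintype Z] {N : ℕ} (P : Fin N → Z → ℝ)
    (hP : ∀ k, ∑ z, P k z = 1) : ∑ z : Fin N → Z, ∏ k, P k (z k) = 1 := by
  have h := Finset.prod_univ_sum (fun _ : Fin N => (Finset.univ : Finset Z)) P
  rw [Fintype.piFinset_univ] at h
  rw [← h]
  simp [hP]

theorem sum_fin_succ_pi {Z : Type} [Fintype Z] {N : ℕ} (F : (Fin (N + 1) → Z) → ℝ) :
    ∑ z, F z = ∑ a : Z, ∑ z : Fin N → Z, F (Fin.cons a z) := by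
  rw [← (Fin.consEquiv (fun _ : Fin (N + 1) => Z)).sum_comp, Fintype.sum_prod_type]
  rfl

/-- First and second moments of a sum of i.i.d. centred variables. -/
theorem sum_prod_mul_sum_moments {Z : Type} [Fintype Z] (P f : Z → ℝ)
    (hP : ∑ z, P z = 1) (hf : ∑ z, P z * f z = 0) (N : ℕ) :
    (∑ z : Fin N → Z, (∏ k, P (z k)) * ∑ k, f (z k) = 0) ∧
    ∑ z : Fin N → Z, (∏ k, P (z k)) * (∑ k, f (z k)) ^ 2 = N * ∑ z, P z * f z ^ 2 := by
  induction N with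
  | zero => simp
  | succ N ih =>
    obtain ⟨ih1, ih2⟩ := ih
    have h0 : ∑ z : Fin N → Z, ∏ k, P (z k) = 1 := sum_pi_prod_eq_one _ fun _ => hP
    constructor
    · rw [sum_fin_succ_pi]
      simp only [Fin.prod_univ_succ, Fin.sum_univ_succ, Fin.cons_zero, Fin.cons_succ]
      calc _ = ∑ a, (P a * f a * (∑ z : Fin N → Z, ∏ k, P (z k))
            + P a * ∑ z : Fin N → Z, (∏ k, P (z k)) * ∑ k, f (z k)) := by
            refine Finset.sum_congr rfl fun a _ => ?_
            rw [Finset.mul_sum, Finset.mul_sum, ← Finset.sum_add_distrib]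
            exact Finset.sum_congr rfl fun z _ => by ring
        _ = 0 := by simp [h0, ih1, hf]
    · rw [sum_fin_succ_pi]
      simp only [Fin.prod_univ_succ, Fin.sum_univ_succ, Fin.cons_zero, Fin.cons_succ]
      calc _ = ∑ a, (P a * f a ^ 2 * (∑ z : Fin N → Z, ∏ k, P (z k))
            + 2 * (P a * f a) * (∑ z : Fin N → Z, (∏ k, P (z k)) * ∑ k, f (z k))
            + P a * ∑ z : Fin N → Z, (∏ k, P (z k)) * (∑ k, f (z k)) ^ 2) := by
            refine Finset.sum_congr rfl fun a _ => ?_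
            rw [Finset.mul_sum, Finset.mul_sum, Finset.mul_sum, ← Finset.sum_add_distrib,
              ← Finset.sum_add_distrib]
            exact Finset.sum_congr rfl fun z _ => by ring
        _ = _ := by
            simp only [h0, ih1, ih2, mul_one, mul_zero, add_zero, Finset.sum_add_distrib,
              ← Finset.sum_mul, hP]
            push_cast
            ring

/-- Chebyshev's inequality for the lower tail of an i.i.d. sum. -/
theorem sum_prod_lower_tail_le {Z : Type} [Fintype Z] (P g : Z → ℝ) (hP0 : ∀ z, 0 ≤ P z)
    (hP : ∑ z, P z = 1) (μ δ : ℝ) (hμ : ∑ z, P z * g z = μ) (hδ : 0 < δ) {N : ℕ} (hN : 1 ≤ N) :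
    ∑ z : Fin N → Z, (if N * (μ - δ) < ∑ k, g (z k) then 0 else ∏ k, P (z k))
      ≤ (∑ z, P z * (g z - μ) ^ 2) / (N * δ ^ 2) := by
  have hN' : (0 : ℝ) < N := by exact_mod_cast hN
  have hf : ∑ z, P z * (g z - μ) = 0 := by
    simp [mul_sub, Finset.sum_sub_distrib, hμ, ← Finset.sum_mul, hP]
  have h := (sum_prod_mul_sum_moments P (fun z => g z - μ) hP hf N).2
  rw [le_div_iff₀ (by positivity)]
  suffices H : (∑ z : Fin N → Z, (if N * (μ - δ) < ∑ k, g (z k) then 0 else ∏ k, P (z k)))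
      * (N * δ) ^ 2 ≤ N * ∑ z, P z * (g z - μ) ^ 2 by
    refine le_of_mul_le_mul_left ?_ hN'
    linarith
  rw [← h, Finset.sum_mul]
  refine Finset.sum_le_sum fun z _ => ?_
  have hp : 0 ≤ ∏ k, P (z k) := Finset.prod_nonneg fun k _ => hP0 _
  split_ifs with hz
  · rw [zero_mul]; positivity
  · refine mul_le_mul_of_nonneg_left ?_ hp
    have e : ∑ k, (g (z k) - μ) = (∑ k, g (z k)) - N * μ := by
      simp [Finset.sum_sub_distrib]
    rw [e, ← neg_sq (_ - _)]
    exact pow_le_pow_left₀ (by positivity) (by linarith) 2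

/-- Ratio `p_j(y|b) / p(y)` for the `j`-th bit. -/
noncomputable def bicmBitRatio {Y : Type} [Fintype Y] {m : ℕ}
    (W : (Fin m → Bool) → Y → ℝ) (j : Fin m) (b : Bool) (y : Y) : ℝ :=
  bicmBitMarginal W j b y / ((1 / 2 : ℝ) * ∑ b' : Bool, bicmBitMarginal W j b' y)

theorem bicmBitMarginal_pos {Y : Type} [Fintype Y] {m : ℕ} {W : (Fin m → Bool) → Y → ℝ}
    (hWpos : ∀ x y, 0 < W x y) (j : Fin m) (b : Bool) (y : Y) : 0 < bicmBitMarginal W j b y :=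
  div_pos (Finset.sum_pos (fun x _ => hWpos x y) ⟨fun _ => b, by simp⟩) (by positivity)

theorem bicmBitRatio_pos {Y : Type} [Fintype Y] {m : ℕ} {W : (Fin m → Bool) → Y → ℝ}
    (hWpos : ∀ x y, 0 < W x y) (j : Fin m) (b : Bool) (y : Y) : 0 < bicmBitRatio W j b y :=
  div_pos (bicmBitMarginal_pos hWpos j b y) (mul_pos (by norm_num)
    (Finset.sum_pos (fun b _ => bicmBitMarginal_pos hWpos j b y) Finset.univ_nonempty))

theorem sum_bicmBitRatio {Y : Type} [Fintype Y] {m : ℕ} {W : (Fin m → Bool) → Y → ℝ}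
    (hWpos : ∀ x y, 0 < W x y) (j : Fin m) (y : Y) : ∑ b, bicmBitRatio W j b y = 2 := by
  have h : 0 < ∑ b, bicmBitMarginal W j b y :=
    Finset.sum_pos (fun b _ => bicmBitMarginal_pos hWpos j b y) Finset.univ_nonempty
  unfold bicmBitRatio
  rw [← Finset.sum_div]
  field_simp

/-- The BICM decoding metric has mean one under uniform inputs. -/
theorem sum_prod_bicmBitRatio {Y : Type} [Fintype Y] {m : ℕ} {W : (Fin m → Bool) → Y → ℝ}
    (hWpos : ∀ x y, 0 < W x y) (y : Y) :
    ∑ x : Fin m → Bool, (∏ j, bicmBitRatio W j (x j) y) / 2 ^ m = 1 := by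
  have h := Finset.prod_univ_sum (fun _ : Fin m => (Finset.univ : Finset Bool))
    (fun j b => bicmBitRatio W j b y)
  rw [Fintype.piFinset_univ] at h
  rw [← Finset.sum_div, ← h]
  simp only [sum_bicmBitRatio hWpos]
  simp

/-- The BICM capacity is the mean of the logarithm of the BICM decoding metric. -/
theorem sum_mul_log_bicmBitRatio {Y : Type} [Fintype Y] {m : ℕ} (hm : 1 ≤ m)
    (W : (Fin m → Bool) → Y → ℝ) :
    ∑ z : (Fin m → Bool) × Y, W z.1 z.2 / 2 ^ m * ∑ j, Real.log (bicmBitRatio W j (z.1 j) z.2)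
      = bicmCapacity W := by
  have hp : (2 : ℝ) ^ m = 2 * 2 ^ (m - 1) := by
    rw [← pow_succ', Nat.sub_add_cancel hm]
  unfold bicmCapacity
  simp_rw [Finset.mul_sum (Finset.univ : Finset (Fin m))]
  rw [Finset.sum_comm]
  refine Finset.sum_congr rfl fun j _ => ?_
  rw [Finset.mul_sum]
  rw [Fintype.sum_prod_type, ← Finset.sum_fiberwise (Finset.univ : Finset (Fin m → Bool))
    (fun x => x j)]
  refine Finset.sum_congr rfl fun b _ => ?_
  rw [Finset.sum_comm, Finset.mul_sum]
  refine Finset.sum_congr rfl fun y _ => ?_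
  change _ = 1 / 2 * (bicmBitMarginal W j b y * Real.log (bicmBitRatio W j b y))
  rw [bicmBitMarginal, ← mul_assoc, Finset.sum_div, Finset.mul_sum, Finset.sum_mul]
  refine Finset.sum_congr rfl fun x hx => ?_
  dsimp only
  rw [(Finset.mem_filter.mp hx).2, hp]
  ring

/-- Achievability of the BICM capacity: for every `ε > 0` there are a block length `N ≥ 1`,
a finite (nonempty) message set `M`, an encoder `φ` and a decoder `ψ` whose rate is at least
`∑_j I(B_j;Y) - ε` while the average error probability is at most `ε`. -/
theorem bicm_capacity_achievable {Y : Type} [Fintype Y] (m : ℕ) (hm : 1 ≤ m)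
    (W : (Fin m → Bool) → Y → ℝ)
    (hWpos : ∀ x y, 0 < W x y)
    (hWsum : ∀ x, ∑ y : Y, W x y = 1)
    (ε : ℝ) (hε : 0 < ε) :
    ∃ (N : ℕ) (M : Type) (_ : Fintype M) (_ : Nonempty M)
      (φ : M → (Fin N → (Fin m → Bool))) (ψ : (Fin N → Y) → Option M),
      1 ≤ N ∧
      (1 / (N : ℝ)) * Real.log (Fintype.card M) ≥ bicmCapacity W - ε ∧
      (1 / (Fintype.card M : ℝ)) *
          ∑ w : M, ∑ y ∈ Finset.univ.filter (fun y : Fin N → Y => ψ y ≠ some w),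
            ∏ k : Fin N, W (φ w k) (y k) ≤ ε := by
  have hm2 : (0 : ℝ) < 2 ^ m := by positivity
  set C := bicmCapacity W with hC
  set g : (Fin m → Bool) × Y → ℝ := fun z => ∑ j, Real.log (bicmBitRatio W j (z.1 j) z.2) with hg
  set P : (Fin m → Bool) × Y → ℝ := fun z => W z.1 z.2 / 2 ^ m with hPdef
  have hP0 : ∀ z, 0 ≤ P z := fun z => div_nonneg (hWpos _ _).le hm2.le
  have hP1 : ∑ z, P z = 1 := by
    rw [Fintype.sum_prod_type]
    simp [hPdef, ← Finset.sum_div, hWsum]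
  have hμ : ∑ z, P z * g z = C := sum_mul_log_bicmBitRatio hm W
  have hexpg : ∀ z, Real.exp (g z) = ∏ j, bicmBitRatio W j (z.1 j) z.2 := fun z => by
    rw [hg, Real.exp_sum]
    exact Finset.prod_congr rfl fun j _ => Real.exp_log (bicmBitRatio_pos hWpos _ _ _)
  set v := ∑ z, P z * (g z - C) ^ 2
  have hlim : Filter.Tendsto (fun N : ℕ => v / (ε / 2) ^ 2 / (N : ℝ) + Real.exp (-(ε / 2)) ^ N)
      Filter.atTop (nhds (0 + 0)) :=
    (tendsto_const_div_atTop_nhds_zero_nat _).add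
      (tendsto_pow_atTop_nhds_zero_of_lt_one (Real.exp_pos _).le
        (Real.exp_lt_one_iff.mpr (by linarith)))
  rw [add_zero] at hlim
  obtain ⟨N, hNε, hN⟩ := ((hlim.eventually_lt_const hε).and (Filter.eventually_ge_atTop 1)).exists
  have hN' : (0 : ℝ) < N := by exact_mod_cast hN
  set γ := C - ε / 2 with hγ
  set K := ⌈Real.exp (N * (C - ε))⌉₊ with hK
  have hK0 : 0 < K := Nat.ceil_pos.mpr (Real.exp_pos _)
  have hKr : (0 : ℝ) < K := by exact_mod_cast hK0
  have hKle : Real.exp (N * (C - ε)) ≤ K := Nat.le_ceil _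
  have hKlt : (K : ℝ) < Real.exp (N * (C - ε)) + 1 := Nat.ceil_lt_add_one (Real.exp_pos _).le
  have hcard : (Fintype.card (Fin N → Fin m → Bool) : ℝ) = (2 ^ m) ^ N := by simp
  obtain ⟨M, hMf, φ, ψ, hM, hT⟩ := exists_code_sum_error_le
    (A := Fin N → Fin m → Bool) (B := Fin N → Y)
    (fun x y => ∏ k, W (x k) (y k)) (fun x y => Finset.prod_nonneg fun k _ => (hWpos _ _).le)
    (fun x => sum_pi_prod_eq_one (fun k => W (x k)) fun k => hWsum _)
    (fun x y => N * γ < ∑ k, g (x k, y k))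
    (v / (N * (ε / 2) ^ 2)) (Real.exp (-(N * γ))) (Real.exp_pos _).le
    (by
      rw [hcard, mul_comm ((2 ^ m : ℝ) ^ N), ← div_le_iff₀ (by positivity)]
      refine le_trans (le_of_eq ?_)
        (sum_prod_lower_tail_le P g hP0 hP1 C (ε / 2) hμ (by linarith) hN)
      rw [← (Equiv.arrowProdEquivProdArrow (Fin N) (fun _ => Fin m → Bool) (fun _ => Y)).symm.sum_comp,
        Fintype.sum_prod_type, Finset.sum_div]
      refine Finset.sum_congr rfl fun x _ => ?_
      rw [Finset.sum_div]
      refine Finset.sum_congr rfl fun y _ => ?_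
      simp only [Equiv.arrowProdEquivProdArrow, Equiv.coe_fn_symm_mk, hPdef, Finset.prod_div_distrib,
        Finset.prod_const, Finset.card_univ, Fintype.card_fin, ← hγ]
      rw [ite_div, zero_div])
    (by
      intro y
      rw [hcard, mul_comm ((2 ^ m : ℝ) ^ N), ← div_le_iff₀ (by positivity), Finset.sum_div]
      have h1 : ∑ x : Fin N → Fin m → Bool, ∏ k, (∏ j, bicmBitRatio W j (x k j) (y k)) / 2 ^ m
          = 1 := sum_pi_prod_eq_one
        (fun k (x : Fin m → Bool) => (∏ j, bicmBitRatio W j (x j) (y k)) / 2 ^ m)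
        fun k => sum_prod_bicmBitRatio hWpos _
      refine le_of_le_of_eq ?_ (mul_one (Real.exp (-(N * γ))))
      rw [← congrArg (Real.exp (-(N * γ)) * ·) h1, Finset.mul_sum]
      refine Finset.sum_le_sum fun x _ => ?_
      have h2 : ∏ k, (∏ j, bicmBitRatio W j (x k j) (y k)) / 2 ^ m
          = Real.exp (∑ k, g (x k, y k)) / (2 ^ m) ^ N := by
        rw [Real.exp_sum, Finset.prod_div_distrib, Finset.prod_const, Finset.card_univ,
          Fintype.card_fin]
        simp only [hexpg]
      rw [h2, ← mul_div_assoc, ← Real.exp_add]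
      refine div_le_div_of_nonneg_right ?_ (by positivity)
      split_ifs with h
      · exact Real.one_le_exp (by linarith)
      · exact (Real.exp_pos _).le) K
  refine ⟨N, M, hMf, Fintype.card_pos_iff.mp (hM ▸ hK0), φ, ψ, hN, ?_, ?_⟩
  · rw [hM, ge_iff_le, one_div, inv_mul_eq_div, le_div_iff₀ hN', mul_comm]
    exact (Real.le_log_iff_exp_le hKr).mpr hKle
  · rw [hM, one_div, inv_mul_eq_div, div_le_iff₀ hKr, mul_comm ε]
    refine hT.trans (mul_le_mul_of_nonneg_left ?_ hKr.le)
    have h3 : ((K : ℝ) - 1) * Real.exp (-(N * γ)) ≤ Real.exp (-(ε / 2)) ^ N := by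
      rw [← Real.exp_nat_mul]
      calc ((K : ℝ) - 1) * Real.exp (-(N * γ))
          ≤ Real.exp (N * (C - ε)) * Real.exp (-(N * γ)) :=
            mul_le_mul_of_nonneg_right (by linarith) (Real.exp_pos _).le
        _ = _ := by rw [← Real.exp_add]; congr 1; rw [hγ]; ring
    have h4 : v / (N * (ε / 2) ^ 2) = v / (ε / 2) ^ 2 / N := by
      rw [div_div, mul_comm]
    linarith
end

section
/- Let X and Y be finite sets, p(x) a probability distribution on X, p(y|x) > 0 transition probabilities with ∑_{y∈Y} p(y|x) = 1 for each x, and q : X × Y → ℝ_{>0} an arbitrary decoding metric. Then for every ρ with 0 ≤ ρ ≤ 1 and every s > 0, the generalized Gallager function is upper bounded by the (matched) Gallager function: E_0^q(ρ,s) ≤ E_0(ρ); equivalently, ∑_{y∈Y} ( ∑_{x∈X} p(x) p(y|x)^{1/(1+ρ)} )^{1+ρ} ≤ ∑_{y∈Y} ∑_{x∈X} p(x) p(y|x) ( ∑_{x'∈X} p(x') (q(x',y)/q(x,y))^s )^ρ. -/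
open Real BigOperators Finset

/-- A weighted power-mean inequality with a change of measure: Jensen's inequality for
`t ↦ t ^ (1 + ρ)` under the tilted weights `p x * w x / ∑ x', p x' * w x'`. -/
theorem rpow_sum_le_sum_mul_rpow_tilted {X : Type*} [Fintype X] {p a w : X → ℝ} {ρ : ℝ}
    (hp : ∀ x, 0 ≤ p x) (ha : ∀ x, 0 ≤ a x) (hw : ∀ x, 0 < w x)
    (hW : 0 < ∑ x, p x * w x) (hρ : 0 ≤ ρ) :
    (∑ x, p x * a x) ^ (1 + ρ) ≤
      ∑ x, p x * a x ^ (1 + ρ) * ((∑ x', p x' * w x') / w x) ^ ρ := by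
  set W := ∑ x, p x * w x
  have jensen := Real.rpow_arith_mean_le_arith_mean_rpow univ (fun x => p x * w x / W)
    (fun x => a x * (W / w x))
    (fun x _ => div_nonneg (mul_nonneg (hp x) (hw x).le) hW.le)
    (by rw [← Finset.sum_div, div_self hW.ne'])
    (fun x _ => mul_nonneg (ha x) (div_nonneg hW.le (hw x).le))
    (show 1 ≤ 1 + ρ by linarith)
  calc (∑ x, p x * a x) ^ (1 + ρ)
      = (∑ x, p x * w x / W * (a x * (W / w x))) ^ (1 + ρ) := by
        congr 1
        refine Finset.sum_congr rfl fun x _ => ?_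
        have := (hw x).ne'
        field_simp
    _ ≤ ∑ x, p x * w x / W * (a x * (W / w x)) ^ (1 + ρ) := jensen
    _ = ∑ x, p x * a x ^ (1 + ρ) * (W / w x) ^ ρ := by
        refine Finset.sum_congr rfl fun x _ => ?_
        have hx := (hw x).ne'
        have hd : 0 < W / w x := div_pos hW (hw x)
        rw [Real.mul_rpow (ha x) hd.le, Real.rpow_add hd, Real.rpow_one]
        field_simp

/-- The expectation of a positive function under a finite probability distribution is positive. -/
theorem sum_mul_pos_of_sum_eq_one {X : Type*} [Fintype X] {p f : X → ℝ}
    (hp : ∀ x, 0 ≤ p x) (hp1 : ∑ x, p x = 1) (hf : ∀ x, 0 < f x) :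
    0 < ∑ x, p x * f x := by
  obtain ⟨x, -, hx⟩ : ∃ x ∈ univ, 0 < p x :=
    Finset.exists_lt_of_sum_lt (by simp [hp1] : ∑ _x : X, (0 : ℝ) < ∑ x, p x)
  exact Finset.sum_pos' (fun x _ => mul_nonneg (hp x) (hf x).le)
    ⟨x, mem_univ x, mul_pos hx (hf x)⟩

/-- Data-processing inequality for error exponents: for any decoding metric `q > 0`,
any `0 ≤ ρ ≤ 1` and any `s > 0`, the generalized Gallager function is upper bounded by
the matched Gallager function, `E_0^q(ρ,s) ≤ E_0(ρ)`. Natural logarithms. -/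
theorem generalized_gallager_le_gallager {X Y : Type} [Fintype X] [Fintype Y]
    (p : X → ℝ) (hp : ∀ x, 0 ≤ p x) (hp1 : ∑ x : X, p x = 1)
    (P : X → Y → ℝ) (hP : ∀ x y, 0 < P x y) (hPs : ∀ x, ∑ y : Y, P x y = 1)
    (q : X → Y → ℝ) (hq : ∀ x y, 0 < q x y)
    (ρ s : ℝ) (hρ0 : 0 ≤ ρ) (hρ1 : ρ ≤ 1) (hs : 0 < s) :
    -Real.log (∑ y : Y, ∑ x : X, p x * P x y *
        (∑ x' : X, p x' * (q x' y / q x y) ^ s) ^ ρ) ≤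
      -Real.log (∑ y : Y, (∑ x : X, p x * P x y ^ (1 / (1 + ρ))) ^ (1 + ρ)) := by
  have hY : Nonempty Y := by
    by_contra! hempty
    simp at hPs
    have : IsEmpty X := ⟨hPs⟩
    simp at hp1
  refine neg_le_neg (Real.log_le_log ?_ (Finset.sum_le_sum fun y _ => ?_))
  · exact Finset.sum_pos (fun y _ => Real.rpow_pos_of_pos
      (sum_mul_pos_of_sum_eq_one hp hp1 fun x => Real.rpow_pos_of_pos (hP x y) _) _)
      univ_nonempty
  · have hw : ∀ x, 0 < q x y ^ s := fun x => Real.rpow_pos_of_pos (hq x y) s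
    refine (rpow_sum_le_sum_mul_rpow_tilted hp (fun x => (Real.rpow_pos_of_pos (hP x y) _).le) hw
      (sum_mul_pos_of_sum_eq_one hp hp1 hw) hρ0).trans_eq ?_
    refine Finset.sum_congr rfl fun x _ => ?_
    rw [← Real.rpow_mul (hP x y).le, one_div_mul_cancel (by linarith), Real.rpow_one,
      Finset.sum_div]
    simp_rw [Real.div_rpow (hq _ y).le (hq x y).le, mul_div_assoc]
end

section
/- Let Y be a finite set, m ≥ 1, X = {0,1}^m the constellation of binary labels, W(x)(y) > 0 the channel transition probabilities with ∑_{y∈Y} W(x)(y) = 1 for each x, and let the input distribution be uniform, p(x) = 2^{-m}. Let q_j : {0,1} × Y → ℝ_{>0} for j = 1,…,m be arbitrary bit metrics, and let the BICM symbol metric be q(x,y) = ∏_{j=1}^m q_j(x_j, y). Then for every ρ with 0 ≤ ρ ≤ 1 and every s > 0, the BICM generalized Gallager function is upper bounded by the coded modulation Gallager function: −log ∑_{y∈Y} ∑_{x∈X} 2^{-m} W(x)(y) ( ∑_{x'∈X} 2^{-m} ∏_{j=1}^m (q_j(x'_j,y)/q_j(x_j,y))^s )^ρ ≤ −log ∑_{y∈Y}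 ( ∑_{x∈X} 2^{-m} W(x)(y)^{1/(1+ρ)} )^{1+ρ}. -/
open Real BigOperators Finset

/-- Over a nonempty finite input set, the inner Gallager sum with an arbitrary positive metric `r`
is bounded below by the one with the metric matched to `w`. -/
lemma rpow_sum_le_sum_mul_metric_ratio {ι : Type*} [Fintype ι] [Nonempty ι] (p w r : ι → ℝ)
    (hp : ∀ i, 0 < p i) (hw : ∀ i, 0 < w i) (hr : ∀ i, 0 < r i) {ρ : ℝ} (hρ : 0 ≤ ρ) :
    (∑ i, p i * w i ^ (1 / (1 + ρ))) ^ (1 + ρ) ≤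
      ∑ i, p i * w i * (∑ k, p k * (r k / r i)) ^ ρ := by
  set S := ∑ k, p k * r k with hS
  have hS0 : 0 < S := Finset.sum_pos (fun i _ => mul_pos (hp i) (hr i)) Finset.univ_nonempty
  have hρ' : (1 + ρ) ≠ 0 := by positivity
  have jensen := Real.rpow_arith_mean_le_arith_mean_rpow Finset.univ
    (fun i => p i * r i / S) (fun i => w i ^ (1 / (1 + ρ)) * (S / r i))
    (fun i _ => (div_pos (mul_pos (hp i) (hr i)) hS0).le)
    (by rw [← Finset.sum_div, ← hS, div_self hS0.ne'])
    (fun i _ => (mul_pos (Real.rpow_pos_of_pos (hw i) _) (div_pos hS0 (hr i))).le)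
    (p := 1 + ρ) (by linarith)
  convert jensen using 2 with i
  · refine Finset.sum_congr rfl fun i _ => ?_
    have := (hr i).ne'
    field_simp
  · have hri := (hr i).ne'
    have hratio : ∑ k, p k * (r k / r i) = S / r i := by
      simp_rw [hS, Finset.sum_div, mul_div_assoc]
    have hpos : 0 < S / r i := div_pos hS0 (hr i)
    rw [hratio, Real.mul_rpow (Real.rpow_nonneg (hw i).le _) hpos.le, ← Real.rpow_mul (hw i).le,
      one_div_mul_cancel hρ', Real.rpow_one, Real.rpow_add hpos, Real.rpow_one]
    field_simp

/-- The BICM generalized Gallager function (for the mismatched symbol metric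
`q(x,y) = ∏_j q_j(x_j,y)` built from arbitrary positive bit metrics, uniform inputs)
is upper bounded by the coded modulation Gallager function:
`E_0^{bicm}(ρ,s) ≤ E_0^{cm}(ρ)` for `0 ≤ ρ ≤ 1` and `s > 0`. Natural logarithms. -/
theorem bicm_gallager_le_cm_gallager {Y : Type} [Fintype Y] (m : ℕ) (hm : 1 ≤ m)
    (W : (Fin m → Bool) → Y → ℝ)
    (hW : ∀ x y, 0 < W x y) (hWs : ∀ x, ∑ y : Y, W x y = 1)
    (q : Fin m → Bool → Y → ℝ) (hq : ∀ j b y, 0 < q j b y)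
    (ρ s : ℝ) (hρ0 : 0 ≤ ρ) (hρ1 : ρ ≤ 1) (hs : 0 < s) :
    -Real.log (∑ y : Y, ∑ x : Fin m → Bool, ((2 : ℝ) ^ m)⁻¹ * W x y *
        (∑ x' : Fin m → Bool, ((2 : ℝ) ^ m)⁻¹ *
          ∏ j : Fin m, (q j (x' j) y / q j (x j) y) ^ s) ^ ρ) ≤
      -Real.log (∑ y : Y,
        (∑ x : Fin m → Bool, ((2 : ℝ) ^ m)⁻¹ * W x y ^ (1 / (1 + ρ))) ^ (1 + ρ)) := by
  have hY : Nonempty Y := by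
    by_contra h
    rw [not_nonempty_iff] at h
    simpa using hWs fun _ => false
  have hc : (0 : ℝ) < ((2 : ℝ) ^ m)⁻¹ := by positivity
  refine neg_le_neg (Real.log_le_log ?_ (Finset.sum_le_sum fun y _ => ?_))
  · exact Finset.sum_pos (fun y _ => Real.rpow_pos_of_pos (Finset.sum_pos
      (fun x _ => mul_pos hc (Real.rpow_pos_of_pos (hW x y) _)) Finset.univ_nonempty) _)
      Finset.univ_nonempty
  · have hmetric (x x' : Fin m → Bool) : ∏ j : Fin m, (q j (x' j) y / q j (x j) y) ^ s =
        (∏ j, q j (x' j) y ^ s) / ∏ j, q j (x j) y ^ s := by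
      rw [← Finset.prod_div_distrib]
      exact Finset.prod_congr rfl fun j _ => Real.div_rpow (hq _ _ _).le (hq _ _ _).le s
    simp_rw [hmetric]
    exact rpow_sum_le_sum_mul_metric_ratio (fun _ => ((2 : ℝ) ^ m)⁻¹) (fun x => W x y)
      (fun x => ∏ j, q j (x j) y ^ s) (fun _ => hc) (fun x => hW x y)
      (fun x => Finset.prod_pos fun j _ => Real.rpow_pos_of_pos (hq _ _ _) _) hρ0
end

section
/- Let X and Y be finite sets, p(x) a probability distribution on X, p(y|x) > 0 transition probabilities with ∑_{y∈Y} p(y|x) = 1 for each x, and q : X × Y → ℝ_{>0} an arbitrary decoding metric. Then the generalized cutoff rate of the mismatched decoder is upper bounded by the coded modulation cutoff rate: sup_{s>0} E_0^q(1,s) ≤ E_0(1), where E_0(1) = −log ∑_{y∈Y} ( ∑_{x∈X} p(x) p(y|x)^{1/2} )^2. -/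
open Real BigOperators Finset

/-- Cauchy–Schwarz bound for a single output letter, valid for any positive weights `w`. -/
lemma sq_sum_mul_sqrt_le_sum_sum_div {X : Type*} [Fintype X] {p f w : X → ℝ}
    (hp : ∀ x, 0 ≤ p x) (hf : ∀ x, 0 ≤ f x) (hw : ∀ x, 0 < w x) :
    (∑ x, p x * √(f x)) ^ 2 ≤ ∑ x, p x * f x * ∑ x', p x' * (w x' / w x) := by
  have hsum : ∑ x, p x * f x * ∑ x', p x' * (w x' / w x) =
      (∑ x, p x * f x / w x) * ∑ x', p x' * w x' := by
    rw [Finset.sum_mul]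
    refine Finset.sum_congr rfl fun x _ => ?_
    rw [Finset.mul_sum, Finset.mul_sum]
    exact Finset.sum_congr rfl fun x' _ => by ring
  rw [hsum]
  refine Finset.sum_sq_le_sum_mul_sum_of_sq_le_mul _
    (fun x _ => div_nonneg (mul_nonneg (hp x) (hf x)) (hw x).le)
    (fun x _ => mul_nonneg (hp x) (hw x).le) fun x _ => le_of_eq ?_
  have := (hw x).ne'
  rw [mul_pow, Real.sq_sqrt (hf x)]
  field_simp

/-- The generalized cutoff rate of a mismatched decoder is upper bounded by the
(coded modulation) cutoff rate: `sup_{s>0} E_0^q(1,s) ≤ E_0(1)`. Natural logarithms. -/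
theorem generalized_cutoff_rate_le_cutoff_rate {X Y : Type} [Fintype X] [Fintype Y]
    (p : X → ℝ) (hp : ∀ x, 0 ≤ p x) (hp1 : ∑ x : X, p x = 1)
    (P : X → Y → ℝ) (hP : ∀ x y, 0 < P x y) (hPs : ∀ x, ∑ y : Y, P x y = 1)
    (q : X → Y → ℝ) (hq : ∀ x y, 0 < q x y) :
    (⨆ s : Set.Ioi (0 : ℝ),
        -Real.log (∑ y : Y, ∑ x : X, p x * P x y *
          (∑ x' : X, p x' * (q x' y / q x y) ^ (s : ℝ)))) ≤
      -Real.log (∑ y : Y, (∑ x : X, p x * P x y ^ ((1 : ℝ) / 2)) ^ (2 : ℝ)) := by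
  have : Nonempty (Set.Ioi (0 : ℝ)) := ⟨⟨1, Set.mem_Ioi.2 one_pos⟩⟩
  obtain ⟨x₀, -, hx₀⟩ : ∃ x ∈ Finset.univ, p x ≠ 0 :=
    Finset.exists_ne_zero_of_sum_ne_zero (by rw [hp1]; exact one_ne_zero)
  obtain ⟨y₀, -, -⟩ : ∃ y ∈ Finset.univ, P x₀ y ≠ 0 :=
    Finset.exists_ne_zero_of_sum_ne_zero (by rw [hPs]; exact one_ne_zero)
  refine ciSup_le fun s => neg_le_neg (Real.log_le_log ?_ (Finset.sum_le_sum fun y _ => ?_))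
  · refine Finset.sum_pos (fun y _ => Real.rpow_pos_of_pos ?_ _) ⟨y₀, Finset.mem_univ _⟩
    exact Finset.sum_pos' (fun x _ => mul_nonneg (hp x) (Real.rpow_nonneg (hP x y).le _))
      ⟨x₀, Finset.mem_univ _, mul_pos ((hp x₀).lt_of_ne' hx₀) (Real.rpow_pos_of_pos (hP x₀ y) _)⟩
  · simp only [Real.div_rpow (hq _ y).le (hq _ y).le, ← Real.sqrt_eq_rpow, Real.rpow_two]
    exact sq_sum_mul_sqrt_le_sum_sum_div hp (fun x => (hP x y).le)
      fun x => Real.rpow_pos_of_pos (hq x y) _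
end

section
/- Let Y be a finite set, m ≥ 1, X = {0,1}^m, W(x)(y) > 0 channel transition probabilities with ∑_{y∈Y} W(x)(y) = 1 for each x, and q_j : {0,1} × Y → ℝ_{>0} bit metrics, with BICM symbol metric q(x,y) = ∏_{j=1}^m q_j(x_j,y). Define the bit marginals p_j(y|b) = 2^{-(m-1)} ∑_{x : x_j = b} W(x)(y). Then for every s > 0, the generalized mutual information of the BICM mismatched decoder with uniform inputs equals the sum of the generalized mutual informations of the m binary-input subchannels: ∑_{x∈X} 2^{-m} ∑_{y∈Y} W(x)(y) · log( (∏_{j=1}^m q_j(x_j,y)^s) / ( ∑_{x'∈X} 2^{-m} ∏_{j=1}^m q_j(x'_j,y)^s ) ) = ∑_{j=1}^m ½ ∑_{b∈{0,1}} ∑_{y∈Y} p_j(y|b) · log( q_j(b,y)^s / ( ½ ∑_{b'∈{0,1}} q_j(b',y)^s ) ). -/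
open Real BigOperators Finset

theorem sum_inv_two_pow_mul_prod {m : ℕ} (f : Fin m → Bool → ℝ) :
    ∑ x : Fin m → Bool, ((2 : ℝ) ^ m)⁻¹ * ∏ j : Fin m, f j (x j) =
      ∏ j : Fin m, (1 / 2 : ℝ) * ∑ b : Bool, f j b := by
  rw [← Finset.mul_sum, Finset.prod_mul_distrib, Finset.prod_univ_sum, Fintype.piFinset_univ]
  simp

theorem sum_mul_comp_eq_sum_fiber {α β : Type*} [Fintype α] [Fintype β] [DecidableEq β]
    (w : α → ℝ) (φ : α → β) (g : β → ℝ) :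
    ∑ x, w x * g (φ x) = ∑ b, (∑ x ∈ Finset.univ.filter (fun x => φ x = b), w x) * g b := by
  rw [← Finset.sum_fiberwise Finset.univ φ]
  refine Finset.sum_congr rfl fun b _ => ?_
  rw [Finset.sum_mul]
  refine Finset.sum_congr rfl fun x hx => ?_
  rw [(Finset.mem_filter.mp hx).2]

/-- The generalized mutual information of the BICM mismatched decoder (symbol metric
`q(x,y) = ∏_j q_j(x_j,y)`, uniform inputs) equals the sum of the generalized mutual
informations of the `m` binary-input parallel subchannels with bit marginals
`p_j(y|b) = 2^{-(m-1)} ∑_{x : x_j = b} W(x)(y)`. Natural logarithms. -/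
theorem gmi_bicm_decomposition {Y : Type} [Fintype Y] (m : ℕ) (hm : 1 ≤ m)
    (W : (Fin m → Bool) → Y → ℝ)
    (hW : ∀ x y, 0 < W x y) (hWs : ∀ x, ∑ y : Y, W x y = 1)
    (q : Fin m → Bool → Y → ℝ) (hq : ∀ j b y, 0 < q j b y)
    (s : ℝ) (hs : 0 < s) :
    ∑ x : Fin m → Bool, ((2 : ℝ) ^ m)⁻¹ * ∑ y : Y, W x y *
        Real.log ((∏ j : Fin m, q j (x j) y ^ s) /
          (∑ x' : Fin m → Bool, ((2 : ℝ) ^ m)⁻¹ * ∏ j : Fin m, q j (x' j) y ^ s)) =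
      ∑ j : Fin m, (1 / 2 : ℝ) * ∑ b : Bool, ∑ y : Y,
        ((∑ x ∈ Finset.univ.filter (fun x : Fin m → Bool => x j = b), W x y) /
            2 ^ (m - 1)) *
          Real.log (q j b y ^ s / ((1 / 2 : ℝ) * ∑ b' : Bool, q j b' y ^ s)) := by
  have hpos : ∀ j b y, 0 < q j b y ^ s := fun j b y => Real.rpow_pos_of_pos (hq j b y) s
  have hlog : ∀ (x : Fin m → Bool) (y : Y),
      Real.log ((∏ j : Fin m, q j (x j) y ^ s) /
          (∑ x' : Fin m → Bool, ((2 : ℝ) ^ m)⁻¹ * ∏ j : Fin m, q j (x' j) y ^ s)) =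
        ∑ j : Fin m,
          Real.log (q j (x j) y ^ s / ((1 / 2 : ℝ) * ∑ b' : Bool, q j b' y ^ s)) := by
    intro x y
    rw [sum_inv_two_pow_mul_prod (fun j b => q j b y ^ s), ← Finset.prod_div_distrib,
      Real.log_prod]
    intro j _
    have hden : 0 < ∑ b' : Bool, q j b' y ^ s :=
      Finset.sum_pos (fun b _ => hpos j b y) Finset.univ_nonempty
    have hnum := hpos j (x j) y
    positivity
  have hpow : (2 : ℝ) ^ m = 2 * 2 ^ (m - 1) := by
    rw [← pow_succ', Nat.sub_add_cancel hm]
  simp_rw [hlog, Finset.mul_sum (Finset.univ : Finset (Fin m))]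
  calc
    _ = ((2 : ℝ) ^ m)⁻¹ * ∑ j : Fin m, ∑ y : Y, ∑ x : Fin m → Bool, W x y *
        Real.log (q j (x j) y ^ s / ((1 / 2 : ℝ) * ∑ b' : Bool, q j b' y ^ s)) := by
      rw [← Finset.mul_sum, Finset.sum_comm]
      congr 1
      rw [Finset.sum_comm (s := (Finset.univ : Finset (Fin m)))]
      refine Finset.sum_congr rfl fun y _ => ?_
      rw [Finset.sum_comm]
    _ = _ := by
      rw [Finset.mul_sum]
      refine Finset.sum_congr rfl fun j _ => ?_
      rw [Finset.sum_comm (s := (Finset.univ : Finset Bool)), Finset.mul_sum, Finset.mul_sum]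
      refine Finset.sum_congr rfl fun y _ => ?_
      generalize (1 / 2 : ℝ) * ∑ b' : Bool, q j b' y ^ s = d
      rw [sum_mul_comp_eq_sum_fiber (fun x => W x y) (fun x => x j)
          (fun b => Real.log (q j b y ^ s / d)), Finset.mul_sum, Finset.mul_sum]
      refine Finset.sum_congr rfl fun b _ => ?_
      rw [hpow, mul_inv]
      ring
end

section
/- Let Y be a finite set, m ≥ 1, X = {0,1}^m, and W(x)(y) > 0 channel transition probabilities with ∑_{y∈Y} W(x)(y) = 1 for each x. Take the classical BICM bit metrics q_j(b,y) = ∑_{x' : x'_j = b} W(x')(y) and the symbol metric q(x,y) = ∏_{j=1}^m q_j(x_j,y). Then the generalized mutual information of this mismatched decoder with uniform inputs equals the BICM capacity: sup_{s>0} I_gmi(s) = ∑_{j=1}^m I(B_j;Y), where the supremum is attained at s = 1; here I(B_j;Y) = ½ ∑_{b∈{0,1}} ∑_{y∈Y} p_j(y|b) log( p_j(y|b) / (½ ∑_{b'∈{0,1}} p_j(y|b')) ) with p_j(y|b) = 2^{-(m-1)} ∑_{x : x_j = b} W(x)(y). -/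
open Real BigOperators Finset

/-- Classical BICM bit metric `q_j(b,y) = ∑_{x' : x'_j = b} W(x')(y)`. -/
noncomputable def bicmBitMetric {Y : Type} [Fintype Y] {m : ℕ}
    (W : (Fin m → Bool) → Y → ℝ) (j : Fin m) (b : Bool) (y : Y) : ℝ :=
  ∑ x' ∈ Finset.univ.filter (fun x' : Fin m → Bool => x' j = b), W x' y

/-- Classical BICM symbol metric `q(x,y) = ∏_j q_j(x_j,y)`. -/
noncomputable def bicmSymbolMetric {Y : Type} [Fintype Y] {m : ℕ}
    (W : (Fin m → Bool) → Y → ℝ) (x : Fin m → Bool) (y : Y) : ℝ :=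
  ∏ j : Fin m, bicmBitMetric W j (x j) y

/-- Generalized mutual information `I_gmi(s)` of the classical BICM decoder
with uniform inputs. Natural logarithms. -/
noncomputable def bicmGmi {Y : Type} [Fintype Y] {m : ℕ}
    (W : (Fin m → Bool) → Y → ℝ) (s : ℝ) : ℝ :=
  ∑ x : Fin m → Bool, ((2 : ℝ) ^ m)⁻¹ * ∑ y : Y, W x y *
    Real.log (bicmSymbolMetric W x y ^ s /
      ∑ x' : Fin m → Bool, ((2 : ℝ) ^ m)⁻¹ * bicmSymbolMetric W x' y ^ s)

/-- The bit metrics of a strictly positive channel are strictly positive. -/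
lemma bicmBitMetric_pos {Y : Type} [Fintype Y] {m : ℕ} {W : (Fin m → Bool) → Y → ℝ}
    (hW : ∀ x y, 0 < W x y) (j : Fin m) (b : Bool) (y : Y) : 0 < bicmBitMetric W j b y :=
  Finset.sum_pos (fun x _ => hW x y) ⟨fun _ => b, by simp⟩

/-- Averaging a function of the `j`-th bit against the channel only involves the bit metric. -/
lemma sum_mul_apply_eq_sum_bicmBitMetric_mul {Y : Type} [Fintype Y] {m : ℕ}
    (W : (Fin m → Bool) → Y → ℝ) (j : Fin m) (y : Y) (g : Bool → ℝ) :
    ∑ x, W x y * g (x j) = ∑ b, bicmBitMetric W j b y * g b := by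
  rw [← Finset.sum_fiberwise Finset.univ (fun x : Fin m → Bool => x j)]
  refine Finset.sum_congr rfl fun b _ => ?_
  rw [bicmBitMetric, Finset.sum_mul]
  refine Finset.sum_congr rfl fun x hx => ?_
  rw [(Finset.mem_filter.mp hx).2]

/-- The normalizing sum of a product metric factors over the bits. -/
lemma sum_bicmSymbolMetric_rpow {Y : Type} [Fintype Y] {m : ℕ} {W : (Fin m → Bool) → Y → ℝ}
    (hW : ∀ x y, 0 < W x y) (s : ℝ) (y : Y) :
    ∑ x : Fin m → Bool, ((2 : ℝ) ^ m)⁻¹ * bicmSymbolMetric W x y ^ s =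
      ∏ j : Fin m, (1 / 2 : ℝ) * ∑ b : Bool, bicmBitMetric W j b y ^ s := by
  rw [Finset.prod_mul_distrib, Finset.prod_univ_sum, ← Finset.mul_sum, Fintype.piFinset_univ]
  congr 1
  · simp
  · refine Finset.sum_congr rfl fun x _ => ?_
    exact (Real.finsetProd_rpow _ _ (fun j _ => (bicmBitMetric_pos hW j _ y).le) s).symm

/-- The symbol information density is the sum of the bit information densities. -/
lemma log_bicmSymbolMetric_rpow_div {Y : Type} [Fintype Y] {m : ℕ}
    {W : (Fin m → Bool) → Y → ℝ} (hW : ∀ x y, 0 < W x y) (s : ℝ) (x : Fin m → Bool) (y : Y) :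
    Real.log (bicmSymbolMetric W x y ^ s /
        ∑ x' : Fin m → Bool, ((2 : ℝ) ^ m)⁻¹ * bicmSymbolMetric W x' y ^ s) =
      ∑ j : Fin m, Real.log (bicmBitMetric W j (x j) y ^ s /
        ((1 / 2 : ℝ) * ∑ b : Bool, bicmBitMetric W j b y ^ s)) := by
  have hq := fun j b => bicmBitMetric_pos hW j b y
  rw [sum_bicmSymbolMetric_rpow hW, bicmSymbolMetric,
    ← Real.finsetProd_rpow _ _ (fun j _ => (hq j _).le), ← Finset.prod_div_distrib,
    Real.log_prod]
  intro j _
  have hsum : 0 < ∑ b : Bool, bicmBitMetric W j b y ^ s :=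
    Finset.sum_pos (fun b _ => Real.rpow_pos_of_pos (hq j b) s) Finset.univ_nonempty
  have := Real.rpow_pos_of_pos (hq j (x j)) s
  positivity

/-- The generalized mutual information of the BICM decoder as a sum over the bit positions. -/
lemma bicmGmi_eq_sum {Y : Type} [Fintype Y] {m : ℕ} {W : (Fin m → Bool) → Y → ℝ}
    (hW : ∀ x y, 0 < W x y) (s : ℝ) :
    bicmGmi W s = ((2 : ℝ) ^ m)⁻¹ * ∑ j : Fin m, ∑ y : Y, ∑ b : Bool, bicmBitMetric W j b y *
      Real.log (bicmBitMetric W j b y ^ s /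
        ((1 / 2 : ℝ) * ∑ b' : Bool, bicmBitMetric W j b' y ^ s)) := by
  have swap : ∀ g : Fin m → Bool → Y → ℝ, ∑ x, ∑ y, W x y * ∑ j, g j (x j) y =
      ∑ j, ∑ y, ∑ b, bicmBitMetric W j b y * g j b y := by
    intro g
    simp_rw [← sum_mul_apply_eq_sum_bicmBitMetric_mul, Finset.mul_sum]
    rw [Finset.sum_comm, Finset.sum_comm (s := (Finset.univ : Finset (Fin m)))]
    exact Finset.sum_congr rfl fun y _ => Finset.sum_comm
  rw [bicmGmi, ← Finset.mul_sum]
  simp_rw [log_bicmSymbolMetric_rpow_div hW]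
  rw [swap fun j b y => Real.log (bicmBitMetric W j b y ^ s /
    ((1 / 2 : ℝ) * ∑ b' : Bool, bicmBitMetric W j b' y ^ s))]

/-- The BICM capacity expressed through the bit metrics. -/
lemma bicmCapacity_eq_sum {Y : Type} [Fintype Y] {m : ℕ} (hm : 1 ≤ m)
    (W : (Fin m → Bool) → Y → ℝ) :
    bicmCapacity W = ((2 : ℝ) ^ m)⁻¹ * ∑ j : Fin m, ∑ y : Y, ∑ b : Bool,
      bicmBitMetric W j b y * Real.log (bicmBitMetric W j b y /
        ((1 / 2 : ℝ) * ∑ b' : Bool, bicmBitMetric W j b' y)) := by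
  have hmarg : ∀ j b y, bicmBitMarginal W j b y = bicmBitMetric W j b y / 2 ^ (m - 1) :=
    fun _ _ _ => rfl
  have hpow : (2 : ℝ) ^ m = 2 * 2 ^ (m - 1) := by
    rw [← pow_succ', Nat.sub_add_cancel hm]
  have hne : (2 : ℝ) ^ (m - 1) ≠ 0 := by positivity
  rw [bicmCapacity, Finset.mul_sum]
  refine Finset.sum_congr rfl fun j _ => ?_
  rw [Finset.sum_comm, Finset.mul_sum, Finset.mul_sum]
  refine Finset.sum_congr rfl fun y _ => ?_
  rw [Finset.mul_sum Finset.univ _ (1 / 2 : ℝ), Finset.mul_sum Finset.univ _ ((2 : ℝ) ^ m)⁻¹]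
  refine Finset.sum_congr rfl fun b _ => ?_
  simp_rw [hmarg]
  rw [← Finset.sum_div, mul_div_assoc', div_div_div_cancel_right₀ hne, hpow]
  field_simp

/-- Gibbs' inequality for positive weights, normalized by their sums up to a common factor. -/
lemma sum_mul_log_div_le {ι : Type*} [Fintype ι] [Nonempty ι] {p r : ι → ℝ} {c : ℝ} (hc : 0 < c)
    (hp : ∀ i, 0 < p i) (hr : ∀ i, 0 < r i) :
    ∑ i, p i * Real.log (r i / (c * ∑ k, r k)) ≤ ∑ i, p i * Real.log (p i / (c * ∑ k, p k)) := by
  have hR : 0 < ∑ k, r k := Finset.sum_pos (fun i _ => hr i) Finset.univ_nonempty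
  have hP : 0 < ∑ k, p k := Finset.sum_pos (fun i _ => hp i) Finset.univ_nonempty
  set R := ∑ k, r k with hRdef
  set P := ∑ k, p k with hPdef
  have key : ∀ i, p i * Real.log (r i / (c * R)) ≤
      p i * Real.log (p i / (c * P)) + (P / R * r i - p i) := by
    intro i
    have hri := hr i
    have hpi := hp i
    have hlog := Real.log_le_sub_one_of_pos
      (show 0 < (r i / (c * R)) / (p i / (c * P)) by positivity)
    rw [Real.log_div (by positivity) (by positivity)] at hlog
    have hmul := mul_le_mul_of_nonneg_left hlog hpi.le
    have hsimp : p i * ((r i / (c * R)) / (p i / (c * P)) - 1) = P / R * r i - p i := by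
      field_simp
    linarith
  refine (Finset.sum_le_sum fun i _ => key i).trans_eq ?_
  rw [Finset.sum_add_distrib, Finset.sum_sub_distrib, ← Finset.mul_sum, ← hRdef, ← hPdef,
    div_mul_cancel₀ _ hR.ne', sub_self, add_zero]

/-- The generalized mutual information of the classical BICM mismatched decoder equals the
BICM capacity: the supremum over `s > 0` of `I_gmi(s)` is attained at `s = 1` and equals
`∑_j I(B_j;Y)`. -/
theorem gmi_bicm_eq_bicm_capacity {Y : Type} [Fintype Y] (m : ℕ) (hm : 1 ≤ m)
    (W : (Fin m → Bool) → Y → ℝ)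
    (hW : ∀ x y, 0 < W x y) (hWs : ∀ x, ∑ y : Y, W x y = 1) :
    bicmGmi W 1 = bicmCapacity W ∧
    (∀ s : ℝ, 0 < s → bicmGmi W s ≤ bicmCapacity W) ∧
    (⨆ s : Set.Ioi (0 : ℝ), bicmGmi W s) = bicmCapacity W := by
  have heq : bicmGmi W 1 = bicmCapacity W := by
    rw [bicmGmi_eq_sum hW, bicmCapacity_eq_sum hm]
    simp_rw [Real.rpow_one]
  have hle : ∀ s : ℝ, bicmGmi W s ≤ bicmCapacity W := by
    intro s
    rw [bicmGmi_eq_sum hW, bicmCapacity_eq_sum hm]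
    refine mul_le_mul_of_nonneg_left (Finset.sum_le_sum fun j _ => Finset.sum_le_sum fun y _ => ?_)
      (by positivity)
    exact sum_mul_log_div_le one_half_pos (fun b => bicmBitMetric_pos hW j b y)
      fun b => Real.rpow_pos_of_pos (bicmBitMetric_pos hW j b y) s
  refine ⟨heq, fun s _ => hle s, ?_⟩
  have : Nonempty (Set.Ioi (0 : ℝ)) := ⟨⟨1, Set.mem_Ioi.mpr one_pos⟩⟩
  refine le_antisymm (ciSup_le fun s => hle s) ?_
  rw [← heq]
  exact le_ciSup (f := fun s : Set.Ioi (0 : ℝ) => bicmGmi W s)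
    ⟨bicmCapacity W, by rintro _ ⟨s, rfl⟩; exact hle s⟩ ⟨1, Set.mem_Ioi.mpr one_pos⟩
end

section
/- Let Y be a finite set and w : {0,1} → Y → ℝ a binary-input channel with w(b)(y) > 0 and ∑_{y∈Y} w(b)(y) = 1 for each b ∈ {0,1}, with uniform input distribution. Then for every s > 0, the generalized mutual information of the matched decoder with metric w(b)(y)^s is maximized at s = 1 and equals the mutual information: ½ ∑_{b∈{0,1}} ∑_{y∈Y} w(b)(y) log( w(b)(y)^s / ( ½ ∑_{b'∈{0,1}} w(b')(y)^s ) ) ≤ ½ ∑_{b∈{0,1}} ∑_{y∈Y} w(b)(y) log( w(b)(y) / ( ½ ∑_{b'∈{0,1}} w(b')(y) ) ). -/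
open Real BigOperators Finset

/-- A tangent-line bound comparing the score of an arbitrary positive metric value `A` (with
normalisation `c * T`) to that of the matched one `a` (with normalisation `c * t`). -/
lemma mul_log_div_le_mul_log_div_add {a A t T c : ℝ} (ha : 0 < a) (hA : 0 < A) (ht : 0 < t)
    (hT : 0 < T) (hc : 0 < c) :
    a * log (A / (c * T)) ≤ a * log (a / (c * t)) + (A * t / T - a) := by
  have h_log : log (A / (c * T)) - log (a / (c * t)) ≤ A * t / (T * a) - 1 := by
    rw [← log_div (by positivity) (by positivity)]
    have h_eq : A / (c * T) / (a / (c * t)) = A * t / (T * a) := by field_simp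
    rw [h_eq]
    exact log_le_sub_one_of_pos (by positivity)
  have h_mul := mul_le_mul_of_nonneg_left h_log ha.le
  have h_eq : a * (A * t / (T * a) - 1) = A * t / T - a := by field_simp
  linarith

/-- **Gibbs' inequality** for unnormalised positive weights: the score is maximized by the matched
metric. -/
lemma sum_mul_log_div_le_sum_mul_log_div {ι : Type*} [Fintype ι] [Nonempty ι] {p q : ι → ℝ}
    (hp : ∀ i, 0 < p i) (hq : ∀ i, 0 < q i) {c : ℝ} (hc : 0 < c) :
    ∑ i, p i * log (q i / (c * ∑ j, q j)) ≤ ∑ i, p i * log (p i / (c * ∑ j, p j)) := by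
  have hP : 0 < ∑ j, p j := sum_pos (fun i _ => hp i) univ_nonempty
  have hQ : 0 < ∑ j, q j := sum_pos (fun i _ => hq i) univ_nonempty
  have h := sum_le_sum fun i (_ : i ∈ univ) =>
    mul_log_div_le_mul_log_div_add (hp i) (hq i) hP hQ hc
  rwa [sum_add_distrib, sum_sub_distrib, ← sum_div, ← sum_mul,
    mul_div_cancel_left₀ _ hQ.ne', sub_self, add_zero] at h

/-- For a binary-input channel with uniform inputs and the matched decoding metric
`q(b,y) = w(b)(y)`, the generalized mutual information `I_gmi(s)` is maximized at `s = 1`,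
where it equals the mutual information `I(B;Y)`. Natural logarithms. -/
theorem gmi_binary_matched_maximized_at_one {Y : Type} [Fintype Y]
    (w : Bool → Y → ℝ) (hw : ∀ b y, 0 < w b y) (hws : ∀ b, ∑ y : Y, w b y = 1)
    (s : ℝ) (hs : 0 < s) :
    (1 / 2 : ℝ) * ∑ b : Bool, ∑ y : Y, w b y *
        Real.log (w b y ^ s / ((1 / 2 : ℝ) * ∑ b' : Bool, w b' y ^ s)) ≤
      (1 / 2 : ℝ) * ∑ b : Bool, ∑ y : Y, w b y *
        Real.log (w b y / ((1 / 2 : ℝ) * ∑ b' : Bool, w b' y)) := by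
  refine mul_le_mul_of_nonneg_left ?_ (by norm_num)
  rw [sum_comm, sum_comm (f := fun b y => w b y * log (w b y / (1 / 2 * ∑ b', w b' y)))]
  exact sum_le_sum fun y _ => sum_mul_log_div_le_sum_mul_log_div (fun b => hw b y)
    (fun b => rpow_pos_of_pos (hw b y) s) (by norm_num)
end

section
/- Let X and Y be finite sets, p(x) a probability distribution on X, p(y|x) > 0 transition probabilities with ∑_{y∈Y} p(y|x) = 1 for each x, and q : X × Y → ℝ_{>0} an arbitrary decoding metric. Then for every s > 0 the generalized mutual information is upper bounded by the mutual information of the channel: ∑_{x∈X} ∑_{y∈Y} p(x) p(y|x) log( q(x,y)^s / ∑_{x'∈X} p(x') q(x',y)^s ) ≤ ∑_{x∈X} ∑_{y∈Y} p(x) p(y|x) log( p(y|x) / ∑_{x'∈X} p(x') p(y|x') ). -/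
open Real BigOperators Finset

/-- The Gibbs inequality for the tilted weights `p * f` and `p * g`, each normalized to total mass
`1`. -/
theorem sum_mul_log_div_sum_le {X : Type*} [Fintype X] (p f g : X → ℝ) (hp : ∀ x, 0 ≤ p x)
    (hp1 : ∑ x, p x = 1) (hf : ∀ x, 0 < f x) (hg : ∀ x, 0 < g x) :
    ∑ x, p x * f x * Real.log (g x / ∑ x', p x' * g x') ≤
      ∑ x, p x * f x * Real.log (f x / ∑ x', p x' * f x') := by
  obtain ⟨x₀, -, hx₀⟩ : ∃ x ∈ Finset.univ, 0 < p x :=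
    Finset.exists_lt_of_sum_lt (by simp [hp1])
  have mass_pos (h : X → ℝ) (hh : ∀ x, 0 < h x) : 0 < ∑ x, p x * h x :=
    Finset.sum_pos' (fun x _ => mul_nonneg (hp x) (hh x).le)
      ⟨x₀, Finset.mem_univ _, mul_pos hx₀ (hh x₀)⟩
  have hF := mass_pos f hf
  have hG := mass_pos g hg
  set F := ∑ x, p x * f x
  set G := ∑ x, p x * g x with hGdef
  have pointwise (x : X) : p x * f x * Real.log (g x / G) ≤
      p x * f x * Real.log (f x / F) + (p x * g x * (F / G) - p x * f x) := by
    have hfx := hf x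
    have ha := div_pos (hg x) hG
    have hb := div_pos hfx hF
    have hlog := Real.log_le_sub_one_of_pos (div_pos ha hb)
    rw [Real.log_div ha.ne' hb.ne'] at hlog
    have hmul := mul_le_mul_of_nonneg_left hlog (mul_nonneg (hp x) hfx.le)
    have heq : p x * f x * (g x / G / (f x / F) - 1) =
        p x * g x * (F / G) - p x * f x := by
      field_simp
    linarith
  refine (Finset.sum_le_sum fun x _ => pointwise x).trans_eq ?_
  rw [Finset.sum_add_distrib, Finset.sum_sub_distrib, ← Finset.sum_mul, ← hGdef,
    mul_div_cancel₀ _ hG.ne', sub_self, add_zero]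

/-- The generalized mutual information of a mismatched decoder is upper bounded by the
mutual information of the channel: for every `s > 0`, `I_gmi(s) ≤ I(X;Y)`.
Natural logarithms. -/
theorem gmi_le_mutual_information {X Y : Type} [Fintype X] [Fintype Y]
    (p : X → ℝ) (hp : ∀ x, 0 ≤ p x) (hp1 : ∑ x : X, p x = 1)
    (P : X → Y → ℝ) (hP : ∀ x y, 0 < P x y) (hPs : ∀ x, ∑ y : Y, P x y = 1)
    (q : X → Y → ℝ) (hq : ∀ x y, 0 < q x y)
    (s : ℝ) (hs : 0 < s) :
    ∑ x : X, ∑ y : Y, p x * P x y *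
        Real.log (q x y ^ s / ∑ x' : X, p x' * q x' y ^ s) ≤
      ∑ x : X, ∑ y : Y, p x * P x y *
        Real.log (P x y / ∑ x' : X, p x' * P x' y) := by
  rw [Finset.sum_comm, Finset.sum_comm (f := fun x y => p x * P x y * Real.log (P x y / _))]
  exact Finset.sum_le_sum fun y _ =>
    sum_mul_log_div_sum_le p (P · y) (q · y ^ s) hp hp1 (hP · y)
      fun x => Real.rpow_pos_of_pos (hq x y) s
end

section
/- Let X and Y be finite sets, p(x) a probability distribution on X, p(y|x) > 0 transition probabilities with ∑_{y∈Y} p(y|x) = 1 for each x, q : X × Y → ℝ_{>0} a decoding metric, and s > 0. Then the function ρ ↦ E_0^q(ρ,s) = −log ∑_{y∈Y} ∑_{x∈X} p(x) p(y|x) ( ∑_{x'∈X} p(x') (q(x',y)/q(x,y))^s )^ρ has derivative at ρ = 0 equal to the generalized mutual information: its derivative at 0 is I_gmi(s) = ∑_{x∈X} ∑_{y∈Y} p(x) p(y|x) log( q(x,y)^s / ∑_{x'∈X} p(x') q(x',y)^s ). -/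
open Real BigOperators Finset

/-- Differentiating `ρ ↦ -log 𝔼[a ^ ρ]` at `0` gives `-𝔼[log a]`, for positive `a` and weights `w`
summing to one. -/
theorem hasDerivAt_neg_log_sum_mul_rpow {ι : Type*} (t : Finset ι) (w a : ι → ℝ)
    (hw : ∑ i ∈ t, w i = 1) (ha : ∀ i ∈ t, 0 < a i) :
    HasDerivAt (fun ρ : ℝ => -Real.log (∑ i ∈ t, w i * a i ^ ρ))
      (-∑ i ∈ t, w i * Real.log (a i)) 0 := by
  have hsum : HasDerivAt (fun ρ : ℝ => ∑ i ∈ t, w i * a i ^ ρ)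
      (∑ i ∈ t, w i * Real.log (a i)) 0 := by
    refine HasDerivAt.fun_sum fun i hi => ?_
    simpa using ((Real.hasStrictDerivAt_const_rpow (ha i hi) 0).hasDerivAt).const_mul (w i)
  have hlog := hsum.log (by simp [hw])
  simpa [hw] using hlog.fun_neg

/-- The derivative at `ρ = 0` of the generalized Gallager function `ρ ↦ E_0^q(ρ,s)` is the
generalized mutual information `I_gmi(s)`. Real powers are `Real.rpow`; natural logarithms. -/
theorem gallager_derivative_at_zero_eq_gmi {X Y : Type} [Fintype X] [Fintype Y]
    (p : X → ℝ) (hp : ∀ x, 0 ≤ p x) (hp1 : ∑ x : X, p x = 1)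
    (P : X → Y → ℝ) (hP : ∀ x y, 0 < P x y) (hPs : ∀ x, ∑ y : Y, P x y = 1)
    (q : X → Y → ℝ) (hq : ∀ x y, 0 < q x y)
    (s : ℝ) (hs : 0 < s) :
    HasDerivAt (fun ρ : ℝ =>
        -Real.log (∑ y : Y, ∑ x : X, p x * P x y *
          (∑ x' : X, p x' * (q x' y / q x y) ^ s) ^ ρ))
      (∑ x : X, ∑ y : Y, p x * P x y *
        Real.log (q x y ^ s / ∑ x' : X, p x' * q x' y ^ s)) 0 := by
  have hS : ∀ y, 0 < ∑ x' : X, p x' * q x' y ^ s := by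
    intro y
    obtain ⟨x, hx, hpx⟩ := Finset.exists_ne_zero_of_sum_ne_zero (hp1 ▸ one_ne_zero)
    exact Finset.sum_pos' (fun x' _ => mul_nonneg (hp x') (rpow_nonneg (hq x' y).le s))
      ⟨x, hx, mul_pos ((hp x).lt_of_ne' hpx) (rpow_pos_of_pos (hq x y) s)⟩
  have hratio : ∀ x y, ∑ x' : X, p x' * (q x' y / q x y) ^ s =
      (∑ x' : X, p x' * q x' y ^ s) / q x y ^ s := by
    intro x y
    rw [Finset.sum_div]
    refine Finset.sum_congr rfl fun x' _ => ?_
    rw [div_rpow (hq x' y).le (hq x y).le, mul_div_assoc]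
  have hw : ∑ i : Y × X, p i.2 * P i.2 i.1 = 1 := by
    rw [Fintype.sum_prod_type, Finset.sum_comm]
    simp [← Finset.mul_sum, hPs, hp1]
  have h := hasDerivAt_neg_log_sum_mul_rpow Finset.univ
    (fun i : Y × X => p i.2 * P i.2 i.1)
    (fun i => (∑ x' : X, p x' * q x' i.1 ^ s) / q i.2 i.1 ^ s) hw
    (fun i _ => div_pos (hS i.1) (rpow_pos_of_pos (hq i.2 i.1) s))
  simp only [Fintype.sum_prod_type] at h
  simp only [hratio]
  convert h using 1
  rw [Finset.sum_comm, ← Finset.sum_neg_distrib]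
  refine Finset.sum_congr rfl fun y _ => ?_
  rw [← Finset.sum_neg_distrib]
  refine Finset.sum_congr rfl fun x _ => ?_
  rw [← mul_neg, ← Real.log_inv, inv_div]
end

section
/- Let Y be a finite set, m ≥ 1, and for each j = 1,…,m let p_j : {0,1} → Y → ℝ be binary-input channels with p_j(y|b) > 0 and ∑_{y∈Y} p_j(y|b) = 1, and let q_j : {0,1} × Y → ℝ_{>0} be bit metrics. Then for every ρ ≥ 0, the sum of the per-subchannel generalized Gallager functions equals the generalized Gallager function of a mismatched decoder acting on the product channel with vector output y' ∈ Y^m in which the m subchannels are statistically independent: −∑_{j=1}^m log[ ∑_{y∈Y} ∑_{b∈{0,1}} ½ p_j(y|b) ( ∑_{b'∈{0,1}} ½ (q_j(b',y)/q_j(b,y))^{1/(1+ρ)} )^ρ ] = −log[ ∑_{y'∈Y^m} ∑_{x∈{0,1}^m} 2^{-m} ( ∏_{j=1}^m p_j(y'_j|x_j) ) ( ∑_{x'∈{0,1}^m} 2^{-m} ∏_{j=1}^m (q_j(x'_j,y'_j)/q_j(x_j,y'_j))^{1/(1+ρ)} )^ρ ]. -/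
open Real BigOperators Finset

/-- The sum over the label positions of the per-subchannel generalized Gallager functions
(with `s = 1/(1+ρ)`) equals the generalized Gallager function of a mismatched decoder acting
on the product channel with vector output `y' ∈ Y^m` in which the `m` binary-input
subchannels are statistically independent. Natural logarithms. -/
theorem parallel_channel_gallager_product_form {Y : Type} [Fintype Y] (m : ℕ) (hm : 1 ≤ m)
    (p : Fin m → Bool → Y → ℝ)
    (hp : ∀ j b y, 0 < p j b y) (hps : ∀ j b, ∑ y : Y, p j b y = 1)
    (q : Fin m → Bool → Y → ℝ) (hq : ∀ j b y, 0 < q j b y)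
    (ρ : ℝ) (hρ : 0 ≤ ρ) :
    -∑ j : Fin m, Real.log (∑ y : Y, ∑ b : Bool, (1 / 2 : ℝ) * p j b y *
        (∑ b' : Bool, (1 / 2 : ℝ) * (q j b' y / q j b y) ^ (1 / (1 + ρ))) ^ ρ) =
      -Real.log (∑ y' : Fin m → Y, ∑ x : Fin m → Bool, ((2 : ℝ) ^ m)⁻¹ *
        (∏ j : Fin m, p j (x j) (y' j)) *
        (∑ x' : Fin m → Bool, ((2 : ℝ) ^ m)⁻¹ *
          ∏ j : Fin m, (q j (x' j) (y' j) / q j (x j) (y' j)) ^ (1 / (1 + ρ))) ^ ρ) := by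
  have hY : Nonempty Y := by
    by_contra h
    rw [not_nonempty_iff] at h
    simpa using hps ⟨0, hm⟩ true
  have hA : ∀ j b y,
      0 < ∑ b' : Bool, (1 / 2 : ℝ) * (q j b' y / q j b y) ^ (1 / (1 + ρ)) := fun j b y =>
    sum_pos (fun b' _ => mul_pos (by norm_num)
      (Real.rpow_pos_of_pos (div_pos (hq j b' y) (hq j b y)) _)) univ_nonempty
  have hG : ∀ j, (∑ y : Y, ∑ b : Bool, (1 / 2 : ℝ) * p j b y *
      (∑ b' : Bool, (1 / 2 : ℝ) * (q j b' y / q j b y) ^ (1 / (1 + ρ))) ^ ρ) ≠ 0 := fun j =>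
    (sum_pos (fun y _ => sum_pos (fun b _ => mul_pos (mul_pos (by norm_num) (hp j b y))
      (Real.rpow_pos_of_pos (hA j b y) _)) univ_nonempty) univ_nonempty).ne'
  rw [← Real.log_prod fun j _ => hG j, Fintype.prod_sum]
  congr 2
  refine sum_congr rfl fun y' _ => ?_
  rw [Fintype.prod_sum]
  refine sum_congr rfl fun x _ => ?_
  rw [prod_mul_distrib, Real.finsetProd_rpow _ _ fun j _ => (hA j (x j) (y' j)).le,
    Fintype.prod_sum]
  simp only [prod_mul_distrib, prod_const, card_univ, Fintype.card_fin, one_div, inv_pow]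
end

section
/- Let Y be a finite set, m ≥ 1, X = {0,1}^m, W(x)(y) > 0 channel transition probabilities with ∑_{y∈Y} W(x)(y) = 1 for each x, and uniform inputs p(x) = 2^{-m}. Suppose the decoder uses the symbol metric q(x,y) = W(x)(y)^m (as arises from perfect extrinsic side information). Then for every ρ with 0 ≤ ρ ≤ 1, the mismatched error exponent coincides with that of coded modulation: E_0^q(ρ, s) ≤ E_0^{cm}(ρ) for all s > 0, with equality at s = 1/(m(1+ρ)); in particular sup_{s>0} E_0^q(ρ,s) = E_0^{cm}(ρ). -/
open Real BigOperators Finset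

/-- Generalized Gallager function `E_0^q(ρ,s)` for the symbol metric
`q(x,y) = W(x)(y)^m` (perfect extrinsic side information), uniform inputs. -/
noncomputable def E0perfectExt {Y : Type} [Fintype Y] {m : ℕ}
    (W : (Fin m → Bool) → Y → ℝ) (ρ s : ℝ) : ℝ :=
  -Real.log (∑ y : Y, ∑ x : Fin m → Bool, ((2 : ℝ) ^ m)⁻¹ * W x y *
    (∑ x' : Fin m → Bool, ((2 : ℝ) ^ m)⁻¹ *
      ((W x' y ^ (m : ℝ)) / (W x y ^ (m : ℝ))) ^ s) ^ ρ)

/-- Coded modulation Gallager function `E_0^{cm}(ρ)` with uniform inputs. -/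
noncomputable def E0cm {Y : Type} [Fintype Y] {m : ℕ}
    (W : (Fin m → Bool) → Y → ℝ) (ρ : ℝ) : ℝ :=
  -Real.log (∑ y : Y,
    (∑ x : Fin m → Bool, ((2 : ℝ) ^ m)⁻¹ * W x y ^ (1 / (1 + ρ))) ^ (1 + ρ))

section GallagerKernel

variable {ι : Type*} [Fintype ι] [Nonempty ι] {w a b : ι → ℝ} {ρ : ℝ}

/-- Averages of a power of a mismatched ratio dominate the matched Gallager kernel. -/
theorem rpow_sum_mul_rpow_le_sum_mul_rpow_div (hw : ∀ x, 0 < w x) (ha : ∀ x, 0 < a x)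
    (hb : ∀ x, 0 < b x) (hρ : 0 ≤ ρ) :
    (∑ x, w x * a x ^ (1 / (1 + ρ))) ^ (1 + ρ) ≤
      ∑ x, w x * a x * (∑ x', w x' * (b x' / b x)) ^ ρ := by
  have hρ' : (1 + ρ) ≠ 0 := by positivity
  set B := ∑ x, w x * b x with hB
  have hBpos : 0 < B := sum_pos (fun x _ => mul_pos (hw x) (hb x)) univ_nonempty
  have hA : 0 ≤ ∑ x, w x * a x ^ (1 / (1 + ρ)) :=
    sum_nonneg fun x _ => mul_nonneg (hw x).le (rpow_nonneg (ha x).le _)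
  have jensen := Real.rpow_arith_mean_le_arith_mean_rpow univ (fun x => w x * b x / B)
    (fun x => a x ^ (1 / (1 + ρ)) / b x)
    (fun x _ => div_nonneg (mul_pos (hw x) (hb x)).le hBpos.le)
    (by rw [← sum_div, ← hB, div_self hBpos.ne'])
    (fun x _ => div_nonneg (rpow_nonneg (ha x).le _) (hb x).le)
    (p := 1 + ρ) (by linarith)
  have hleft : ∑ x, w x * b x / B * (a x ^ (1 / (1 + ρ)) / b x) =
      (∑ x, w x * a x ^ (1 / (1 + ρ))) / B := by
    rw [sum_div]
    refine sum_congr rfl fun x _ => ?_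
    have := (hb x).ne'
    field_simp
  rw [hleft, div_rpow hA hBpos.le, div_le_iff₀ (rpow_pos_of_pos hBpos _), sum_mul] at jensen
  refine jensen.trans_eq (sum_congr rfl fun x _ => ?_)
  have hsum : ∑ x', w x' * (b x' / b x) = B / b x := by
    rw [hB, sum_div]
    exact sum_congr rfl fun x' _ => by ring
  have hroot : (a x ^ (1 / (1 + ρ))) ^ (1 + ρ) = a x := by
    rw [← rpow_mul (ha x).le, one_div_mul_cancel hρ', rpow_one]
  rw [hsum, div_rpow (rpow_nonneg (ha x).le _) (hb x).le, hroot, div_rpow hBpos.le (hb x).le,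
    rpow_add (hb x), rpow_add hBpos, rpow_one, rpow_one]
  have h₁ := (hb x).ne'
  have h₂ := (rpow_pos_of_pos (hb x) ρ).ne'
  have h₃ := hBpos.ne'
  field_simp

/-- The matched choice `b = a ^ (1 / (1 + ρ))` attains the Gallager kernel. -/
theorem sum_mul_rpow_div_eq_rpow_sum_mul_rpow (hw : ∀ x, 0 < w x) (ha : ∀ x, 0 < a x)
    (hρ : 0 ≤ ρ) :
    ∑ x, w x * a x * (∑ x', w x' * (a x' ^ (1 / (1 + ρ)) / a x ^ (1 / (1 + ρ)))) ^ ρ =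
      (∑ x, w x * a x ^ (1 / (1 + ρ))) ^ (1 + ρ) := by
  have hρ' : (1 + ρ) ≠ 0 := by positivity
  have hApos : 0 < ∑ x, w x * a x ^ (1 / (1 + ρ)) :=
    sum_pos (fun x _ => mul_pos (hw x) (rpow_pos_of_pos (ha x) _)) univ_nonempty
  rw [rpow_add hApos, rpow_one, sum_mul]
  refine sum_congr rfl fun x _ => ?_
  have hr : 0 < a x ^ (1 / (1 + ρ)) := rpow_pos_of_pos (ha x) _
  have hsum : ∑ x', w x' * (a x' ^ (1 / (1 + ρ)) / a x ^ (1 / (1 + ρ))) =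
      (∑ x', w x' * a x' ^ (1 / (1 + ρ))) / a x ^ (1 / (1 + ρ)) := by
    rw [sum_div]
    exact sum_congr rfl fun x' _ => by ring
  have hsplit : a x = a x ^ (1 / (1 + ρ)) * (a x ^ (1 / (1 + ρ))) ^ ρ := by
    conv_rhs => rw [← rpow_one_add' hr.le hρ', ← rpow_mul (ha x).le,
      one_div_mul_cancel hρ', rpow_one]
  rw [hsum, div_rpow hApos.le hr.le]
  have h₁ := (rpow_pos_of_pos hr ρ).ne'
  rw [mul_div_assoc', div_eq_iff h₁]
  nth_rewrite 1 [hsplit]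
  ring

end GallagerKernel

/-- With the symbol metric `q(x,y) = W(x)(y)^m` arising from perfect extrinsic side
information, the mismatched error exponent coincides with that of coded modulation:
`E_0^q(ρ,s) ≤ E_0^{cm}(ρ)` for all `s > 0`, with equality at `s = 1/(m(1+ρ))`; in
particular `sup_{s>0} E_0^q(ρ,s) = E_0^{cm}(ρ)`. Natural logarithms. -/
theorem perfect_extrinsic_exponent_eq_cm {Y : Type} [Fintype Y] (m : ℕ) (hm : 1 ≤ m)
    (W : (Fin m → Bool) → Y → ℝ)
    (hW : ∀ x y, 0 < W x y) (hWs : ∀ x, ∑ y : Y, W x y = 1)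
    (ρ : ℝ) (hρ0 : 0 ≤ ρ) (hρ1 : ρ ≤ 1) :
    (∀ s : ℝ, 0 < s → E0perfectExt W ρ s ≤ E0cm W ρ) ∧
    E0perfectExt W ρ (1 / ((m : ℝ) * (1 + ρ))) = E0cm W ρ ∧
    (⨆ s : Set.Ioi (0 : ℝ), E0perfectExt W ρ s) = E0cm W ρ := by
  have hpow (s : ℝ) (y : Y) (x x' : Fin m → Bool) :
      (W x' y ^ (m : ℝ) / W x y ^ (m : ℝ)) ^ s = W x' y ^ (m * s) / W x y ^ (m * s) := by
    rw [div_rpow (rpow_nonneg (hW x' y).le _) (rpow_nonneg (hW x y).le _),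
      ← rpow_mul (hW x' y).le, ← rpow_mul (hW x y).le]
  have hw (_ : Fin m → Bool) : 0 < ((2 : ℝ) ^ m)⁻¹ := by positivity
  have hY : Nonempty Y := by
    by_contra h
    rw [not_nonempty_iff] at h
    simpa using hWs fun _ => false
  have hle (s : ℝ) : E0perfectExt W ρ s ≤ E0cm W ρ := by
    unfold E0perfectExt E0cm
    simp only [hpow]
    refine neg_le_neg (log_le_log ?_ (sum_le_sum fun y _ => ?_))
    · exact sum_pos (fun y _ => rpow_pos_of_pos (sum_pos
        (fun x _ => mul_pos (hw x) (rpow_pos_of_pos (hW x y) _)) univ_nonempty) _) univ_nonempty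
    · exact rpow_sum_mul_rpow_le_sum_mul_rpow_div hw (fun x => hW x y)
        (fun x => rpow_pos_of_pos (hW x y) _) hρ0
  have hm0 : (m : ℝ) ≠ 0 := by positivity
  have heq : E0perfectExt W ρ (1 / ((m : ℝ) * (1 + ρ))) = E0cm W ρ := by
    have hexp : (m : ℝ) * (1 / (m * (1 + ρ))) = 1 / (1 + ρ) := by
      field_simp
    unfold E0perfectExt E0cm
    simp only [hpow, hexp]
    congr 2
    exact sum_congr rfl fun y _ =>
      sum_mul_rpow_div_eq_rpow_sum_mul_rpow hw (fun x => hW x y) hρ0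
  refine ⟨fun s _ => hle s, heq, le_antisymm (ciSup_le fun s => hle s) ?_⟩
  have hs : 0 < 1 / ((m : ℝ) * (1 + ρ)) := by positivity
  exact heq.symm.le.trans (le_ciSup (f := fun s : Set.Ioi (0 : ℝ) => E0perfectExt W ρ s)
    ⟨E0cm W ρ, Set.forall_mem_range.2 fun s => hle s⟩ ⟨_, hs⟩)
end
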